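/- Let a, b, c be real, let n ≥ k ≥ 0 be integers, and let (x,y) be real with x ≠ 1; write u(x,y) = P_{n,k}^{(a,b,c)}(x,y). Then: (2k+b+c+1)·∂u/∂x = (n+k+a+b+c+2)(k+b+c+1)·P_{n−1,k}^{(a+1,b,c+1)}(x,y) + (k+b)(n+k+b+c+1)·P_{n−1,k−1}^{(a+1,b,c+1)}(x,y); ∂u/∂y = (k+b+c+1)·P_{n−1,k−1}^{(a,b+1,c+1)}(x,y); and (2k+b+c+1)·(∂u/∂y − ∂u/∂x) = −(n+k+a+b+c+2)(k+b+c+1)·P_{n−1,k}^{(a+1,b+1,c)}(x,y) + (k+c)(n+k+b+c+1)·P_{n−1,k−1}^{(a+1,b+1,c)}(x,y). -/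

import Mathlib

noncomputable section

/-- Generalized binomial coefficient `C(α, j) = α(α−1)⋯(α−j+1)/j!`. -/
def genBinom (α : ℝ) (j : ℕ) : ℝ :=
  (∏ i ∈ Finset.range j, (α - i)) / (Nat.factorial j)

/-- Jacobi polynomial `P_n^{(a,b)}(x)`; zero for negative `n`. -/
def jacobiP (n : ℤ) (a b : ℝ) (x : ℝ) : ℝ :=
  if n < 0 then 0 else
    ∑ m ∈ Finset.range (n.toNat + 1),
      genBinom ((n : ℝ) + a) (n.toNat - m) * genBinom ((n : ℝ) + b) m *
        ((x - 1) / 2) ^ m * ((x + 1) / 2) ^ (n.toNat - m)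

/-- Four-parameter Koornwinder polynomial `P_{n,k}^{(a,b,c,d)}(x,y)`;
zero whenever `k < 0`, `n < 0`, or `k > n` (covering the conventions
`k = −1`, `n = −1`, `k = n+1`). -/
def koornP (n k : ℤ) (a b c d : ℝ) (x y : ℝ) : ℝ :=
  if n < 0 ∨ k < 0 ∨ n < k then 0 else
    jacobiP (n - k) (2 * (k : ℝ) + b + c + d + 1) a (2 * x - 1) *
      (1 - x) ^ k.toNat * jacobiP k c b (-1 + 2 * y / (1 - x))

section

open Finset

lemma genBinom_zero (α : ℝ) : genBinom α 0 = 1 := by simp [genBinom]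

lemma genBinom_succ (α : ℝ) (j : ℕ) :
    genBinom α (j + 1) = genBinom α j * (α - j) / (j + 1) := by
  have h : (j : ℝ) + 1 ≠ 0 := by positivity
  have h' : (Nat.factorial j : ℝ) ≠ 0 := by positivity
  simp only [genBinom, prod_range_succ, Nat.factorial_succ]
  push_cast
  field_simp

lemma genBinom_add_one_succ (α : ℝ) (j : ℕ) :
    genBinom (α + 1) (j + 1) = (α + 1) * genBinom α j / (j + 1) := by
  have h : (j : ℝ) + 1 ≠ 0 := by positivity
  have h' : (Nat.factorial j : ℝ) ≠ 0 := by positivity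
  simp only [genBinom, prod_range_succ', Nat.factorial_succ]
  push_cast
  simp only [add_sub_add_right_eq_sub]
  field_simp
  ring

lemma genBinom_pascal (α : ℝ) (j : ℕ) :
    genBinom (α + 1) (j + 1) = genBinom α (j + 1) + genBinom α j := by
  have h : (j : ℝ) + 1 ≠ 0 := by positivity
  rw [genBinom_add_one_succ, genBinom_succ]
  field_simp
  ring

lemma succ_mul_genBinom_succ (α : ℝ) (j : ℕ) :
    ((j : ℝ) + 1) * genBinom (α + 1) (j + 1) = (α + 1) * genBinom α j := by
  have h : (j : ℝ) + 1 ≠ 0 := by positivity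
  rw [genBinom_add_one_succ]
  field_simp

lemma add_one_mul_genBinom (α : ℝ) (j : ℕ) :
    (α + 1) * genBinom α j = (α + 1 - j) * genBinom (α + 1) j := by
  have h : (j : ℝ) + 1 ≠ 0 := by positivity
  rw [← succ_mul_genBinom_succ, genBinom_succ]
  field_simp

/-- The binary form `∑_{i+j=n} C(α, j) C(β, i) u^i v^j` underlying the Jacobi polynomials. -/
def jacobiForm (n : ℕ) (α β u v : ℝ) : ℝ :=
  ∑ p ∈ antidiagonal n, genBinom α p.2 * genBinom β p.1 * u ^ p.1 * v ^ p.2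

lemma jacobiForm_succ_right (n : ℕ) (α β u v : ℝ) :
    jacobiForm (n + 1) α (β + 1) u v
      = jacobiForm (n + 1) α β u v + u * jacobiForm n α β u v := by
  simp only [jacobiForm, Nat.sum_antidiagonal_succ, mul_sum, add_assoc, ← sum_add_distrib]
  congr 1
  refine sum_congr rfl fun p _ => ?_
  rw [genBinom_pascal]
  ring

lemma jacobiForm_succ_left (n : ℕ) (α β u v : ℝ) :
    jacobiForm (n + 1) (α + 1) β u v
      = jacobiForm (n + 1) α β u v + v * jacobiForm n α β u v := by
  simp only [jacobiForm, Nat.sum_antidiagonal_succ', mul_sum, add_assoc, ← sum_add_distrib]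
  congr 1
  refine sum_congr rfl fun p _ => ?_
  rw [genBinom_pascal]
  ring

lemma jacobiForm_contiguous (n : ℕ) (α β u v : ℝ) :
    (β + 1) * jacobiForm n (α + 1) β u v + (α + 1) * jacobiForm n α (β + 1) u v
      = (α + β + 2 - n) * jacobiForm n (α + 1) (β + 1) u v := by
  simp only [jacobiForm, mul_sum, ← sum_add_distrib]
  refine sum_congr rfl fun p hp => ?_
  have hn : (n : ℝ) = p.1 + p.2 := by exact_mod_cast (mem_antidiagonal.mp hp).symm
  linear_combination
    genBinom (α + 1) p.2 * u ^ p.1 * v ^ p.2 * add_one_mul_genBinom β p.1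
      + genBinom (β + 1) p.1 * u ^ p.1 * v ^ p.2 * add_one_mul_genBinom α p.2
      + genBinom (α + 1) p.2 * genBinom (β + 1) p.1 * u ^ p.1 * v ^ p.2 * hn

/-- The partial derivative of the form in `u` is again such a form. -/
lemma sum_antidiagonal_partial_left (n : ℕ) (α β u v : ℝ) :
    ∑ p ∈ antidiagonal (n + 1),
        genBinom α p.2 * genBinom (β + 1) p.1 * (p.1 * u ^ (p.1 - 1)) * v ^ p.2
      = (β + 1) * jacobiForm n α β u v := by
  simp only [jacobiForm, Nat.sum_antidiagonal_succ, mul_sum]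
  simp only [Nat.cast_zero, zero_mul, mul_zero, zero_add, Nat.add_sub_cancel, Nat.cast_succ]
  refine sum_congr rfl fun p _ => ?_
  linear_combination genBinom α p.2 * u ^ p.1 * v ^ p.2 * succ_mul_genBinom_succ β p.1

/-- The partial derivative of the form in `v` is again such a form. -/
lemma sum_antidiagonal_partial_right (n : ℕ) (α β u v : ℝ) :
    ∑ p ∈ antidiagonal (n + 1),
        genBinom (α + 1) p.2 * genBinom β p.1 * u ^ p.1 * (p.2 * v ^ (p.2 - 1))
      = (α + 1) * jacobiForm n α β u v := by
  simp only [jacobiForm, Nat.sum_antidiagonal_succ', mul_sum]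
  simp only [Nat.cast_zero, zero_mul, mul_zero, zero_add, Nat.add_sub_cancel, Nat.cast_succ]
  refine sum_congr rfl fun p _ => ?_
  linear_combination genBinom β p.1 * u ^ p.1 * v ^ p.2 * succ_mul_genBinom_succ α p.2

/-- Euler's identity for the homogeneous form. -/
lemma jacobiForm_euler (n : ℕ) (α β u v : ℝ) :
    ((n : ℝ) + 1) * jacobiForm (n + 1) (α + 1) (β + 1) u v
      = (β + 1) * u * jacobiForm n (α + 1) β u v
        + (α + 1) * v * jacobiForm n α (β + 1) u v := by
  have key : ∀ (w : ℝ) (i : ℕ), (i : ℝ) * w ^ i = w * (i * w ^ (i - 1)) := by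
    rintro w (_ | i)
    · simp
    · simp only [Nat.add_sub_cancel, pow_succ]
      ring
  rw [mul_right_comm (β + 1), mul_right_comm (α + 1), ← sum_antidiagonal_partial_left,
    ← sum_antidiagonal_partial_right]
  simp only [jacobiForm, mul_sum, sum_mul, ← sum_add_distrib]
  refine sum_congr rfl fun p hp => ?_
  have hn : (n : ℝ) + 1 = p.1 + p.2 := by exact_mod_cast (mem_antidiagonal.mp hp).symm
  linear_combination
    genBinom (α + 1) p.2 * genBinom (β + 1) p.1 * (u ^ p.1 * v ^ p.2 * hn
      + v ^ p.2 * key u p.1 + u ^ p.1 * key v p.2)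

lemma hasDerivAt_jacobiForm (n : ℕ) (α β x : ℝ) :
    HasDerivAt (fun t => jacobiForm (n + 1) (α + 1) (β + 1) ((t - 1) / 2) ((t + 1) / 2))
      (((β + 1) * jacobiForm n (α + 1) β ((x - 1) / 2) ((x + 1) / 2)
        + (α + 1) * jacobiForm n α (β + 1) ((x - 1) / 2) ((x + 1) / 2)) / 2) x := by
  rw [← sum_antidiagonal_partial_left, ← sum_antidiagonal_partial_right, ← sum_add_distrib,
    sum_div]
  unfold jacobiForm
  refine HasDerivAt.fun_sum fun p _ => ?_
  have hu : HasDerivAt (fun t : ℝ => (t - 1) / 2) (1 / 2) x :=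
    ((hasDerivAt_id x).sub_const 1).div_const 2
  have hv : HasDerivAt (fun t : ℝ => (t + 1) / 2) (1 / 2) x :=
    ((hasDerivAt_id x).add_const 1).div_const 2
  refine (((hu.fun_pow p.1).const_mul (genBinom (α + 1) p.2 * genBinom (β + 1) p.1)).fun_mul
    (hv.fun_pow p.2)).congr_deriv ?_
  ring

lemma jacobiP_of_neg {n : ℤ} (hn : n < 0) (a b x : ℝ) : jacobiP n a b x = 0 := by
  simp [jacobiP, hn]

lemma jacobiP_natCast (n : ℕ) (a b x : ℝ) :
    jacobiP n a b x = jacobiForm n (n + a) (n + b) ((x - 1) / 2) ((x + 1) / 2) := by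
  simp [jacobiP, jacobiForm, Nat.sum_antidiagonal_eq_sum_range_succ_mk]

lemma jacobiP_zero (a b x : ℝ) : jacobiP 0 a b x = 1 := by
  simp [jacobiP, genBinom_zero]

/-- Shifting one unit between the two parameters lowers the degree of the difference. -/
lemma jacobiP_shift (n : ℕ) (a b x : ℝ) :
    jacobiP n a (b + 1) x = jacobiP n (a + 1) b x - jacobiP (n - 1) (a + 1) (b + 1) x := by
  rcases n with _ | n
  · simp [jacobiP_zero, jacobiP_of_neg]
  · have h₁ := jacobiForm_succ_left n (n + 1 + a) (n + 1 + b) ((x - 1) / 2) ((x + 1) / 2)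
    have h₂ := jacobiForm_succ_right n (n + 1 + a) (n + 1 + b) ((x - 1) / 2) ((x + 1) / 2)
    rw [show ((n + 1 : ℕ) : ℤ) - 1 = (n : ℕ) by push_cast; ring]
    simp only [jacobiP_natCast]
    push_cast
    rw [← add_assoc, ← add_assoc, show (n : ℝ) + (a + 1) = n + 1 + a by ring,
      show (n : ℝ) + (b + 1) = n + 1 + b by ring]
    linear_combination h₂ - h₁

lemma jacobiP_contiguous (n : ℕ) (a b x : ℝ) :
    ((n : ℝ) + b + 1) * jacobiP n (a + 1) b x + ((n : ℝ) + a + 1) * jacobiP n a (b + 1) x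
      = ((n : ℝ) + a + b + 2) * jacobiP n (a + 1) (b + 1) x := by
  have h := jacobiForm_contiguous n (n + a) (n + b) ((x - 1) / 2) ((x + 1) / 2)
  simp only [jacobiP_natCast, ← add_assoc]
  linear_combination h

lemma jacobiP_raise_left (n : ℕ) (a b x : ℝ) :
    (2 * (n : ℝ) + a + b + 1) * jacobiP n a b x
      = ((n : ℝ) + a + b + 1) * jacobiP n (a + 1) b x
        - ((n : ℝ) + b) * jacobiP (n - 1) (a + 1) b x := by
  have h₁ := jacobiP_contiguous n a (b - 1) x
  have h₂ := jacobiP_shift n a (b - 1) x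
  simp only [sub_add_cancel] at h₁ h₂
  linear_combination h₁ + ((n : ℝ) + b) * h₂

lemma jacobiP_raise_right (n : ℕ) (a b x : ℝ) :
    (2 * (n : ℝ) + a + b + 1) * jacobiP n a b x
      = ((n : ℝ) + a + b + 1) * jacobiP n a (b + 1) x
        + ((n : ℝ) + a) * jacobiP (n - 1) a (b + 1) x := by
  have h₁ := jacobiP_contiguous n (a - 1) b x
  have h₂ := jacobiP_shift n (a - 1) b x
  simp only [sub_add_cancel] at h₁ h₂
  linear_combination h₁ - ((n : ℝ) + a) * h₂

lemma jacobiP_euler (n : ℕ) (a b x : ℝ) :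
    (n : ℝ) * jacobiP n a b x
      = ((n : ℝ) + b) * ((x - 1) / 2) * jacobiP (n - 1) (a + 1) b x
        + ((n : ℝ) + a) * ((x + 1) / 2) * jacobiP (n - 1) a (b + 1) x := by
  rcases n with _ | n
  · simp [jacobiP_of_neg]
  · have h := jacobiForm_euler n (n + a) (n + b) ((x - 1) / 2) ((x + 1) / 2)
    rw [show ((n + 1 : ℕ) : ℤ) - 1 = (n : ℕ) by push_cast; ring]
    simp only [jacobiP_natCast, ← add_assoc]
    push_cast
    rw [add_right_comm (n : ℝ) 1 a, add_right_comm (n : ℝ) 1 b]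
    exact h

lemma jacobiP_pred_contiguous (n : ℕ) (a b x : ℝ) :
    ((n : ℝ) + b) * jacobiP (n - 1) (a + 1) b x + ((n : ℝ) + a) * jacobiP (n - 1) a (b + 1) x
      = ((n : ℝ) + a + b + 1) * jacobiP (n - 1) (a + 1) (b + 1) x := by
  rcases n with _ | n
  · simp [jacobiP_of_neg]
  · have h := jacobiP_contiguous n a b x
    rw [show ((n + 1 : ℕ) : ℤ) - 1 = (n : ℕ) by push_cast; ring]
    push_cast
    linear_combination h

lemma hasDerivAt_jacobiP (n : ℕ) (a b x : ℝ) :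
    HasDerivAt (jacobiP n a b)
      (((n : ℝ) + a + b + 1) / 2 * jacobiP (n - 1) (a + 1) (b + 1) x) x := by
  rw [div_mul_eq_mul_div, ← jacobiP_pred_contiguous]
  rcases n with _ | n
  · have h : jacobiP ((0 : ℕ) : ℤ) a b = fun _ => 1 := funext fun t => jacobiP_zero a b t
    rw [h]
    simpa [jacobiP_of_neg] using hasDerivAt_const x (1 : ℝ)
  · have h := hasDerivAt_jacobiForm n (n + a) (n + b) x
    have hf : jacobiP ((n + 1 : ℕ) : ℤ) a b = fun t =>
        jacobiForm (n + 1) (n + a + 1) (n + b + 1) ((t - 1) / 2) ((t + 1) / 2) := by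
      funext t
      rw [jacobiP_natCast]
      push_cast
      rw [add_right_comm (n : ℝ) 1 a, add_right_comm (n : ℝ) 1 b]
    rw [hf, show ((n + 1 : ℕ) : ℤ) - 1 = (n : ℕ) by push_cast; ring]
    simp only [jacobiP_natCast, ← add_assoc]
    push_cast
    rw [add_right_comm (n : ℝ) 1 a, add_right_comm (n : ℝ) 1 b]
    exact h

lemma jacobiP_ladder_left (n : ℕ) (a b x : ℝ) :
    (1 + x) * (((n : ℝ) + a + b + 1) / 2 * jacobiP (n - 1) (a + 1) (b + 1) x)
        - n * jacobiP n a b x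
      = ((n : ℝ) + b) * jacobiP (n - 1) (a + 1) b x := by
  linear_combination -(1 + x) / 2 * jacobiP_pred_contiguous n a b x - jacobiP_euler n a b x

lemma jacobiP_ladder_right (n : ℕ) (a b x : ℝ) :
    (1 - x) * (((n : ℝ) + a + b + 1) / 2 * jacobiP (n - 1) (a + 1) (b + 1) x)
        + n * jacobiP n a b x
      = ((n : ℝ) + a) * jacobiP (n - 1) a (b + 1) x := by
  linear_combination -(1 - x) / 2 * jacobiP_pred_contiguous n a b x + jacobiP_euler n a b x

lemma jacobiP_lower_left (n : ℕ) (a b x : ℝ) :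
    a * jacobiP n a b x
        - (1 - x) * (((n : ℝ) + a + b + 1) / 2 * jacobiP (n - 1) (a + 1) (b + 1) x)
      = ((n : ℝ) + a) * jacobiP n (a - 1) (b + 1) x := by
  have h := jacobiP_shift n (a - 1) b x
  simp only [sub_add_cancel] at h
  linear_combination -jacobiP_ladder_right n a b x - ((n : ℝ) + a) * h

lemma koornP_eq (n k : ℤ) (a b c d x y : ℝ) :
    koornP n k a b c d x y
      = jacobiP (n - k) (2 * (k : ℝ) + b + c + d + 1) a (2 * x - 1) *
        (1 - x) ^ k.toNat * jacobiP k c b (-1 + 2 * y / (1 - x)) := by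
  unfold koornP
  split_ifs with h
  · rcases lt_or_ge k 0 with hk | hk
    · simp [jacobiP_of_neg hk]
    · simp [jacobiP_of_neg (show n - k < 0 by omega)]
  · rfl

/-- The power `(1 - x)^(k-1)` is harmless next to a factor of degree `k - 1`. -/
lemma pow_mul_jacobiP_pred (k : ℕ) (a b x t : ℝ) :
    (1 - x) * ((1 - x) ^ ((k : ℤ) - 1).toNat * jacobiP (k - 1) a b t)
      = (1 - x) ^ k * jacobiP (k - 1) a b t := by
  rcases k with _ | k
  · simp [jacobiP_of_neg]
  · rw [show ((k + 1 : ℕ) : ℤ) - 1 = (k : ℕ) by push_cast; ring, Int.toNat_natCast, pow_succ]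
    ring

lemma hasDerivAt_koornP_snd (N k : ℕ) (a b c x y : ℝ) (hx : x ≠ 1) :
    HasDerivAt (koornP ((k : ℤ) + N) k a b c 0 x)
      (((k : ℝ) + b + c + 1) * koornP ((k : ℤ) + N - 1) (k - 1) a (b + 1) (c + 1) 0 x y) y := by
  have hx' : 1 - x ≠ 0 := sub_ne_zero.mpr hx.symm
  have ht : HasDerivAt (fun y : ℝ => -1 + 2 * y / (1 - x)) (2 / (1 - x)) y := by
    simpa using (((hasDerivAt_id y).const_mul 2).div_const (1 - x)).const_add (-1)
  have h := ((hasDerivAt_jacobiP k c b (-1 + 2 * y / (1 - x))).comp y ht).const_mul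
    (jacobiP N (2 * (k : ℝ) + b + c + 0 + 1) a (2 * x - 1) * (1 - x) ^ k)
  refine (h.congr_deriv (Eq.symm ?_)).congr_of_eventuallyEq (.of_forall fun t => ?_)
  rotate_left
  · simp [koornP_eq]
  · have hp := pow_mul_jacobiP_pred k (c + 1) (b + 1) x (-1 + 2 * y / (1 - x))
    rw [koornP_eq, show (k : ℤ) + N - 1 - (k - 1) = N by ring]
    push_cast
    rw [show 2 * ((k : ℝ) - 1) + (b + 1) + (c + 1) + 0 + 1 = 2 * k + b + c + 0 + 1 by ring]
    generalize -1 + 2 * y / (1 - x) = t at *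
    generalize jacobiP N (2 * (k : ℝ) + b + c + 0 + 1) a (2 * x - 1) = F at *
    field_simp
    linear_combination F * (k + b + c + 1) * hp

lemma hasDerivAt_koornP_fst (N k : ℕ) (a b c x y : ℝ) (hx : x ≠ 1) :
    HasDerivAt (fun x' => koornP ((k : ℤ) + N) k a b c 0 x' y)
      (((N : ℝ) + (2 * k + b + c + 1) + a + 1)
          * jacobiP (N - 1) (2 * k + b + c + 1 + 1) (a + 1) (2 * x - 1) * (1 - x) ^ k
          * jacobiP k c b (-1 + 2 * y / (1 - x))
        + ((k : ℝ) + b) * jacobiP N (2 * k + b + c + 1) a (2 * x - 1)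
          * ((1 - x) ^ ((k : ℤ) - 1).toNat
            * jacobiP (k - 1) (c + 1) b (-1 + 2 * y / (1 - x)))) x := by
  have hx' : 1 - x ≠ 0 := sub_ne_zero.mpr hx.symm
  have hw : HasDerivAt (fun x : ℝ => 1 - x) (-1) x := (hasDerivAt_id x).const_sub 1
  have hs : HasDerivAt (fun x : ℝ => 2 * x - 1) 2 x := by
    simpa using ((hasDerivAt_id x).const_mul 2).sub_const 1
  have ht : HasDerivAt (fun x : ℝ => -1 + 2 * y / (1 - x)) (2 * y / (1 - x) ^ 2) x := by
    refine (((hasDerivAt_const x (2 * y)).fun_div hw hx').const_add (-1)).congr_deriv ?_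
    ring
  have h := (((hasDerivAt_jacobiP N (2 * k + b + c + 1) a (2 * x - 1)).comp x hs).fun_mul
    (hw.fun_pow k)).fun_mul ((hasDerivAt_jacobiP k c b (-1 + 2 * y / (1 - x))).comp x ht)
  refine (h.congr_deriv (Eq.symm ?_)).congr_of_eventuallyEq (.of_forall fun t => ?_)
  rotate_left
  · simp [koornP_eq]
  · have hp := pow_mul_jacobiP_pred k (c + 1) b x (-1 + 2 * y / (1 - x))
    have hl := jacobiP_ladder_left k c b (-1 + 2 * y / (1 - x))
    have hk : (k : ℝ) * (1 - x) ^ k = (1 - x) * (k * (1 - x) ^ (k - 1)) := by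
      rcases k with _ | k
      · simp
      · simp only [Nat.add_sub_cancel, pow_succ]
        ring
    have hy : (1 - x) * (2 * y / (1 - x) ^ 2) = 1 + (-1 + 2 * y / (1 - x)) := by
      field_simp
      ring
    simp only [Function.comp_apply]
    generalize 2 * y / (1 - x) ^ 2 = z at *
    generalize -1 + 2 * y / (1 - x) = t at *
    generalize jacobiP (↑N - 1) (2 * ↑k + b + c + 1 + 1) (a + 1) (2 * x - 1) = F' at *
    generalize jacobiP (↑N) (2 * ↑k + b + c + 1) a (2 * x - 1) = F at *
    apply mul_left_cancel₀ hx'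
    linear_combination ((k : ℝ) + b) * F * hp - F * (1 - x) ^ k * hl
      - F * jacobiP k c b t * hk
      - F * (1 - x) ^ k * ((k + c + b + 1) / 2 * jacobiP (k - 1) (c + 1) (b + 1) t) * hy

end

theorem koorn_differentiation (a b c : ℝ) (n k : ℤ) (hk : 0 ≤ k) (hnk : k ≤ n)
    (x y : ℝ) (hx : x ≠ 1) :
    ((2 * (k : ℝ) + b + c + 1) * deriv (fun x' => koornP n k a b c 0 x' y) x
      = ((n : ℝ) + (k : ℝ) + a + b + c + 2) * ((k : ℝ) + b + c + 1)
          * koornP (n - 1) k (a + 1) b (c + 1) 0 x y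
        + ((k : ℝ) + b) * ((n : ℝ) + (k : ℝ) + b + c + 1)
          * koornP (n - 1) (k - 1) (a + 1) b (c + 1) 0 x y) ∧
    (deriv (koornP n k a b c 0 x) y
      = ((k : ℝ) + b + c + 1) * koornP (n - 1) (k - 1) a (b + 1) (c + 1) 0 x y) ∧
    ((2 * (k : ℝ) + b + c + 1)
        * (deriv (koornP n k a b c 0 x) y
            - deriv (fun x' => koornP n k a b c 0 x' y) x)
      = -(((n : ℝ) + (k : ℝ) + a + b + c + 2) * ((k : ℝ) + b + c + 1))
          * koornP (n - 1) k (a + 1) (b + 1) c 0 x y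
        + ((k : ℝ) + c) * ((n : ℝ) + (k : ℝ) + b + c + 1)
          * koornP (n - 1) (k - 1) (a + 1) (b + 1) c 0 x y) := by
  obtain ⟨k, rfl⟩ := Int.eq_ofNat_of_zero_le hk
  obtain ⟨N, rfl⟩ := Int.le.dest hnk
  have hx' : 1 - x ≠ 0 := sub_ne_zero.mpr hx.symm
  rw [(hasDerivAt_koornP_fst N k a b c x y hx).deriv,
    (hasDerivAt_koornP_snd N k a b c x y hx).deriv]
  have hF := jacobiP_lower_left N (2 * k + b + c + 1) a (2 * x - 1)
  have hp₁ := pow_mul_jacobiP_pred k (c + 1) b x (-1 + 2 * y / (1 - x))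
  have hp₂ := pow_mul_jacobiP_pred k (c + 1) (b + 1) x (-1 + 2 * y / (1 - x))
  have hp₃ := pow_mul_jacobiP_pred k c (b + 1) x (-1 + 2 * y / (1 - x))
  have hl := jacobiP_raise_left k c b (-1 + 2 * y / (1 - x))
  have hr := jacobiP_raise_right k c b (-1 + 2 * y / (1 - x))
  have hd₁ := jacobiP_ladder_left k c b (-1 + 2 * y / (1 - x))
  have hd₂ := jacobiP_ladder_right k c b (-1 + 2 * y / (1 - x))
  simp only [koornP_eq, Int.toNat_natCast, show (k : ℤ) + N - 1 - (k - 1) = N by ring,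
    show (k : ℤ) + N - 1 - k = N - 1 by ring]
  push_cast
  rw [show 2 * (k : ℝ) + b + (c + 1) + 0 + 1 = 2 * k + b + c + 1 + 1 by ring,
    show 2 * (k : ℝ) + (b + 1) + c + 0 + 1 = 2 * k + b + c + 1 + 1 by ring,
    show 2 * ((k : ℝ) - 1) + b + (c + 1) + 0 + 1 = 2 * k + b + c + 1 - 1 by ring,
    show 2 * ((k : ℝ) - 1) + (b + 1) + c + 0 + 1 = 2 * k + b + c + 1 - 1 by ring,
    show 2 * ((k : ℝ) - 1) + (b + 1) + (c + 1) + 0 + 1 = 2 * k + b + c + 1 by ring]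
  generalize -1 + 2 * y / (1 - x) = t at *
  generalize jacobiP (↑N - 1) (2 * ↑k + b + c + 1 + 1) (a + 1) (2 * x - 1) = F' at *
  generalize jacobiP (↑N) (2 * ↑k + b + c + 1) a (2 * x - 1) = F at *
  generalize jacobiP (↑N) (2 * ↑k + b + c + 1 - 1) (a + 1) (2 * x - 1) = G at *
  set A : ℝ := 2 * k + b + c + 1 with hA
  set w := (1 - x) ^ ((k : ℤ) - 1).toNat
  set Q₁ := jacobiP (k - 1) (c + 1) b t
  set Q₂ := jacobiP (k - 1) (c + 1) (b + 1) t
  set Q₃ := jacobiP (k - 1) c (b + 1) t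
  set E : ℝ := N + A + a + 1 with hE
  refine ⟨?_, rfl, ?_⟩
  · linear_combination (E * F' * (1 - x) ^ k) * hl + (k + b) * w * Q₁ * hF
      + (k + b) * E * F' * hp₁
  · have hQ : w * ((k + b + c + 1) * Q₂ - (k + b) * Q₁) = w * ((k + c) * Q₃) := by
      apply mul_left_cancel₀ hx'
      linear_combination (k + b + c + 1) * hp₂ - (k + b) * hp₁ - (k + c) * hp₃
        + (1 - x) ^ k * (hd₁ + hd₂)
    linear_combination -(E * F' * (1 - x) ^ k) * hr + (k + c) * w * Q₃ * hF
      + (k + c) * E * F' * hp₃ + A * F * hQ
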